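/- arXiv:2211.07766 — 4 statements merged into one kernel-verified Lean document; each statement's English description precedes it below -/
import Mathlib

section
/- Let G be a graph and let K and S be disjoint sets of vertices of G such that K is a clique, every vertex of K is adjacent to every vertex of S, and no edge of G joins two vertices of S. Then there exists a family of pairwise edge-disjoint triangles of G, each consisting of one vertex of S together with an edge of K, of cardinality at least ((|K| − 1)/2)·min{|S|, |K|}. -/
open Finset SimpleGraph

/-- A triangle packing of a graph `G`: a finite set of triangles (3-cliques) of `G`
that are pairwise edge-disjoint (any two distinct triangles share at most one vertex). -/
def IsTrianglePacking {V : Type*} [DecidableEq V] (G : SimpleGraph V)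
    (P : Finset (Finset V)) : Prop :=
  (∀ t ∈ P, G.IsNClique 3 t) ∧
    ∀ t₁ ∈ P, ∀ t₂ ∈ P, t₁ ≠ t₂ → (t₁ ∩ t₂).card ≤ 1

/-- `nu G` is the maximum cardinality of a triangle packing of `G`. -/
noncomputable def nu {V : Type*} [Fintype V] [DecidableEq V] (G : SimpleGraph V) : ℕ :=
  sSup {n | ∃ P : Finset (Finset V), IsTrianglePacking G P ∧ P.card = n}

/-- A triangle hitting set of `G`: a set of edges of `G` whose removal
results in a triangle-free graph. -/
def IsTriangleHitting {V : Type*} (G : SimpleGraph V) (T : Finset (Sym2 V)) : Prop :=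
  ↑T ⊆ G.edgeSet ∧ (G.deleteEdges ↑T).CliqueFree 3

/-- `tau G` is the minimum cardinality of a triangle hitting set of `G`. -/
noncomputable def tau {V : Type*} [Fintype V] [DecidableEq V] (G : SimpleGraph V) : ℕ :=
  sInf {n | ∃ T : Finset (Sym2 V), IsTriangleHitting G T ∧ T.card = n}

/-- A finset with at most as many elements as a nonempty finite type admits a map to that type
which is injective on it. -/
theorem Finset.exists_injOn_of_card_le {α β : Type*} [Fintype β] [Nonempty β]
    (s : Finset α) (h : s.card ≤ Fintype.card β) : ∃ f : α → β, Set.InjOn f s := by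
  classical
  obtain ⟨f⟩ := Function.Embedding.nonempty_of_card_le (α := s) (β := β) (by simpa using h)
  refine ⟨fun x => if hx : x ∈ s then f ⟨x, hx⟩ else Classical.arbitrary β, fun x hx y hy hxy => ?_⟩
  rw [mem_coe] at hx hy
  simpa [hx, hy] using hxy

/-- Two distinct pairs on which a function injective on `K` has equal sums are disjoint. -/
theorem Finset.disjoint_of_sum_eq_of_card_eq_two {V M : Type*} [DecidableEq V]
    [AddCommGroup M] {K e₁ e₂ : Finset V} {f : V → M} (hf : Set.InjOn f K)
    (h₁ : e₁ ∈ K.powersetCard 2) (h₂ : e₂ ∈ K.powersetCard 2) (hne : e₁ ≠ e₂)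
    (hsum : ∑ x ∈ e₁, f x = ∑ x ∈ e₂, f x) : Disjoint e₁ e₂ := by
  rw [mem_powersetCard] at h₁ h₂
  rw [disjoint_left]
  intro x hx₁ hx₂
  apply hne
  obtain ⟨y, hy⟩ := card_eq_one.mp (by rw [card_erase_of_mem hx₁, h₁.2] : (e₁.erase x).card = 1)
  obtain ⟨z, hz⟩ := card_eq_one.mp (by rw [card_erase_of_mem hx₂, h₂.2] : (e₂.erase x).card = 1)
  rw [← add_sum_erase _ _ hx₁, ← add_sum_erase _ _ hx₂, hy, hz, sum_singleton, sum_singleton,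
    add_right_inj] at hsum
  have hyK : y ∈ K := h₁.1 (mem_of_mem_erase (hy ▸ mem_singleton_self y))
  have hzK : z ∈ K := h₂.1 (mem_of_mem_erase (hz ▸ mem_singleton_self z))
  rw [← insert_erase hx₁, ← insert_erase hx₂, hy, hz, hf hyK hzK hsum]

/-- Some value is attained at least the average number of times. -/
theorem Finset.exists_card_le_card_mul_card_fiber {α β : Type*} [Fintype β] [DecidableEq β]
    [Nonempty β] (s : Finset α) (f : α → β) :
    ∃ b, s.card ≤ Fintype.card β * (s.filter fun x => f x = b).card := by
  by_contra! h
  have hsum := card_eq_sum_card_fiberwise (s := s) (t := univ) (f := f) (by simp)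
  have hlt : ∑ b : β, Fintype.card β * (s.filter fun x => f x = b).card < ∑ _b : β, s.card :=
    sum_lt_sum_of_nonempty univ_nonempty fun b _ => h b
  rw [← mul_sum, ← hsum] at hlt
  simp at hlt

/-- If `K` is a clique, `S` is an independent set disjoint from `K`, and `K` and `S` are
complete to each other, then there is a packing of edge-disjoint triangles, each using one
vertex of `S` and one edge of `K`, of cardinality at least `((|K| - 1)/2) · min{|S|, |K|}`. -/
theorem packing_clique_indep (V : Type*) [Fintype V] [DecidableEq V]
    (G : SimpleGraph V) (K S : Finset V)
    (hdisj : Disjoint K S)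
    (hK : G.IsClique ↑K)
    (hcomp : ∀ v ∈ K, ∀ w ∈ S, G.Adj v w)
    (hS : ∀ u ∈ S, ∀ w ∈ S, ¬ G.Adj u w) :
    ∃ P : Finset (Finset V), IsTrianglePacking G P ∧
      (∀ t ∈ P, (t ∩ S).card = 1 ∧ (t ∩ K).card = 2) ∧
      ((K.card : ℝ) - 1) / 2 * min (S.card : ℝ) (K.card : ℝ) ≤ (P.card : ℝ) := by
  rcases K.eq_empty_or_nonempty with rfl | hKne
  · exact ⟨∅, ⟨by simp, by simp⟩, by simp, by simp⟩
  have : NeZero K.card := ⟨hKne.card_pos.ne'⟩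
  obtain ⟨R, hRS, hR⟩ := exists_subset_card_eq (min_le_left S.card K.card)
  obtain ⟨f, hf⟩ := K.exists_injOn_of_card_le (β := ZMod K.card) (by simp [ZMod.card])
  obtain ⟨g, hg⟩ := R.exists_injOn_of_card_le (β := ZMod K.card) (by simp [ZMod.card, hR])
  obtain ⟨a, ha⟩ := (K.powersetCard 2 ×ˢ R).exists_card_le_card_mul_card_fiber
    fun p : Finset V × V => ∑ x ∈ p.1, f x - g p.2
  set Q := (K.powersetCard 2 ×ˢ R).filter
    fun p : Finset V × V => ∑ x ∈ p.1, f x - g p.2 = a with hQ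
  have hmem : ∀ p ∈ Q, p.1 ⊆ K ∧ p.1.card = 2 ∧ p.2 ∈ R ∧ ∑ x ∈ p.1, f x - g p.2 = a := by
    intro p hp
    simpa [hQ, and_assoc] using hp
  have hnotK : ∀ w ∈ R, w ∉ K := fun w hw hwK => disjoint_left.mp hdisj hwK (hRS hw)
  have hinterK : ∀ p ∈ Q, insert p.2 p.1 ∩ K = p.1 := by
    intro p hp
    obtain ⟨h₁, -, h₃, -⟩ := hmem p hp
    rw [insert_inter_of_notMem (hnotK _ h₃), inter_eq_left.mpr h₁]
  have hinterS : ∀ p ∈ Q, insert p.2 p.1 ∩ S = {p.2} := by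
    intro p hp
    obtain ⟨h₁, -, h₃, -⟩ := hmem p hp
    rw [insert_inter_of_mem (hRS h₃), disjoint_iff_inter_eq_empty.mp (hdisj.mono_left h₁)]
    rfl
  have hinj : Set.InjOn (fun p : Finset V × V => insert p.2 p.1) Q := by
    intro p hp q hq hpq
    dsimp only at hpq
    refine Prod.ext ?_ ?_
    · rw [← hinterK p hp, hpq, hinterK q hq]
    · rw [← singleton_inj, ← hinterS p hp, hpq, hinterS q hq]
  refine ⟨Q.image fun p => insert p.2 p.1, ⟨?_, ?_⟩, ?_, ?_⟩
  · simp only [forall_mem_image]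
    intro p hp
    obtain ⟨h₁, h₂, h₃, -⟩ := hmem p hp
    have hedge : G.IsNClique 2 p.1 := ⟨hK.subset (coe_subset.mpr h₁), h₂⟩
    exact hedge.insert fun v hv => (hcomp v (h₁ hv) _ (hRS h₃)).symm
  · simp only [forall_mem_image]
    intro p hp q hq hpq
    obtain ⟨h₁, h₂, h₃, h₄⟩ := hmem p hp
    obtain ⟨k₁, k₂, k₃, k₄⟩ := hmem q hq
    by_cases hw : p.2 = q.2
    · have hne : p.1 ≠ q.1 := fun h => hpq (by rw [h, hw])
      have hdis : Disjoint p.1 q.1 := disjoint_of_sum_eq_of_card_eq_two hf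
        (mem_powersetCard.mpr ⟨h₁, h₂⟩) (mem_powersetCard.mpr ⟨k₁, k₂⟩) hne
        (by rw [← k₄, hw] at h₄; exact sub_left_injective h₄)
      rw [hw, ← insert_inter_distrib, disjoint_iff_inter_eq_empty.mp hdis]
      simp
    · have hne : p.1 ≠ q.1 := by
        intro h
        rw [← k₄, h, sub_right_inj] at h₄
        exact hw (hg h₃ k₃ h₄)
      have hsub : insert p.2 p.1 ∩ insert q.2 q.1 ⊆ p.1 ∩ q.1 := by
        intro x hx
        have hp₂ := hnotK _ h₃
        have hq₂ := hnotK _ k₃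
        simp only [mem_inter, mem_insert] at hx ⊢
        rcases hx with ⟨rfl | hx, hy | hy⟩
        · exact absurd hy hw
        · exact absurd (k₁ hy) hp₂
        · exact absurd (h₁ (hy ▸ hx)) hq₂
        · exact ⟨hx, hy⟩
      refine (card_le_card hsub).trans (Nat.lt_succ_iff.mp (lt_of_not_ge fun hge => hne ?_))
      have e₁ := eq_of_subset_of_card_le (inter_subset_left (s₁ := p.1) (s₂ := q.1))
        (h₂.le.trans hge)
      have e₂ := eq_of_subset_of_card_le (inter_subset_right (s₁ := p.1) (s₂ := q.1))
        (k₂.le.trans hge)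
      exact e₁.symm.trans e₂
  · simp only [forall_mem_image]
    intro p hp
    rw [hinterS p hp, hinterK p hp]
    exact ⟨card_singleton _, (hmem p hp).2.1⟩
  · rw [card_image_of_injOn hinj]
    rw [card_product, card_powersetCard, hR, ZMod.card] at ha
    have ha' : ((K.card.choose 2 : ℕ) : ℝ) * min (S.card : ℝ) K.card ≤ K.card * Q.card := by
      exact_mod_cast ha
    rw [Nat.cast_choose_two] at ha'
    have hpos : (0 : ℝ) < K.card := by exact_mod_cast hKne.card_pos
    refine le_of_mul_le_mul_left ?_ hpos
    calc _ = (K.card : ℝ) * (K.card - 1) / 2 * min (S.card : ℝ) K.card := by ring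
      _ ≤ _ := ha'
end

section
/- Let G be a graph and let K and S be disjoint sets of vertices of G such that K is a clique with |K| even, every vertex of K is adjacent to every vertex of S, and no edge of G joins two vertices of S. Then there exists a family of pairwise edge-disjoint triangles of G, each consisting of one vertex of S together with an edge of K, of cardinality at least (|K|/2)·min{|S|, |K| − 1}. -/
open Finset SimpleGraph

/-- The round-robin pairing on `ZMod n` together with a point at infinity: in round `i`, the
finite points `a` and `b` are paired when `a + b = i`, and infinity with `h * i` (where `h` is
meant to be the inverse of `2`). -/
def roundRobin {n : ℕ} (h i : ZMod n) : Option (ZMod n) → Option (ZMod n)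
  | none => some (h * i)
  | some a => if a = h * i then none else some (i - a)

theorem roundRobin_ne {n : ℕ} {h : ZMod n} (hh : 2 * h = 1) (i : ZMod n)
    (x : Option (ZMod n)) : roundRobin h i x ≠ x := by
  rcases x with _ | a
  · simp [roundRobin]
  · by_cases ha : a = h * i
    · simp [roundRobin, ha]
    · simp only [roundRobin, if_neg ha, ne_eq, Option.some.injEq]
      intro hia
      exact ha (by linear_combination (-a) * hh - h * hia)

theorem roundRobin_roundRobin {n : ℕ} {h : ZMod n} (hh : 2 * h = 1) (i : ZMod n)
    (x : Option (ZMod n)) : roundRobin h i (roundRobin h i x) = x := by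
  rcases x with _ | a
  · simp [roundRobin]
  · by_cases ha : a = h * i
    · simp [roundRobin, ha]
    · have hb : i - a ≠ h * i := fun hb => ha (by linear_combination (-i) * hh - hb)
      simp [roundRobin, ha, hb]

theorem roundRobin_injective {n : ℕ} {h : ZMod n} (hh : 2 * h = 1) {i j : ZMod n}
    {x : Option (ZMod n)} (hx : roundRobin h i x = roundRobin h j x) : i = j := by
  have cancel : ∀ {a b : ZMod n}, h * a = h * b → a = b := fun {a b} hab => by
    linear_combination 2 * hab + (b - a) * hh
  rcases x with _ | a
  · exact cancel (by simpa [roundRobin] using hx)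
  · by_cases hi : a = h * i <;> by_cases hj : a = h * j
    · exact cancel (hi.symm.trans hj)
    · simp [roundRobin, if_pos hi, if_neg hj] at hx
    · simp [roundRobin, if_neg hi, if_pos hj] at hx
    · simpa [roundRobin, if_neg hi, if_neg hj] using hx

/-- The complete graph on a nonempty finite set `K` of even size has a `1`-factorization into
`|K| - 1` perfect matchings, each given by a fixed-point-free involution of `K`. -/
theorem exists_one_factorization {V : Type*} (K : Finset V) (hK : Even K.card)
    (hne : K.Nonempty) :
    ∃ f : Fin (K.card - 1) → V → V,
      (∀ i, ∀ x ∈ K, f i x ∈ K ∧ f i x ≠ x ∧ f i (f i x) = x) ∧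
      ∀ i j, ∀ x ∈ K, f i x = f j x → i = j := by
  classical
  obtain ⟨m, hm⟩ := hK
  have hpos := hne.card_pos
  have : NeZero (K.card - 1) := ⟨by omega⟩
  have hh : (2 : ZMod (K.card - 1)) * (m : ZMod (K.card - 1)) = 1 := by
    have h2 : 2 * m = (K.card - 1) + 1 := by omega
    have h3 : ((2 * m : ℕ) : ZMod (K.card - 1)) = ((K.card - 1 + 1 : ℕ) : ZMod (K.card - 1)) :=
      congrArg _ h2
    rw [Nat.cast_add, ZMod.natCast_self] at h3
    simpa using h3
  have hc : Fintype.card K = Fintype.card (Option (ZMod (K.card - 1))) := by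
    rw [Fintype.card_coe, Fintype.card_option, ZMod.card]
    omega
  have e := Fintype.equivOfCardEq hc
  have c : Fin (K.card - 1) ≃ ZMod (K.card - 1) := Fintype.equivOfCardEq (by simp [ZMod.card])
  refine ⟨fun i x => if hx : x ∈ K then e.symm (roundRobin m (c i) (e ⟨x, hx⟩)) else x, ?_, ?_⟩
  · intro i x hx
    refine ⟨by simp [hx], ?_, by simp [hx, roundRobin_roundRobin hh]⟩
    simp only [hx, dif_pos]
    intro h
    have h' : e.symm (roundRobin m (c i) (e ⟨x, hx⟩)) = ⟨x, hx⟩ := Subtype.ext h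
    rw [Equiv.symm_apply_eq] at h'
    exact roundRobin_ne hh _ _ h'
  · intro i j x hx h
    simp only [hx, dif_pos] at h
    exact c.injective (roundRobin_injective hh (e.symm.injective (Subtype.ext h)))

/-- If `K` is a clique of even size, `S` is an independent set disjoint from `K`, and `K` and
`S` are complete to each other, then there is a packing of edge-disjoint triangles, each using
one vertex of `S` and one edge of `K`, of cardinality at least `(|K|/2) · min{|S|, |K| - 1}`. -/
theorem packing_clique_indep_even (V : Type*) [Fintype V] [DecidableEq V]
    (G : SimpleGraph V) (K S : Finset V)
    (hdisj : Disjoint K S)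
    (hK : G.IsClique ↑K)
    (hKeven : Even K.card)
    (hcomp : ∀ v ∈ K, ∀ w ∈ S, G.Adj v w)
    (hS : ∀ u ∈ S, ∀ w ∈ S, ¬ G.Adj u w) :
    ∃ P : Finset (Finset V), IsTrianglePacking G P ∧
      (∀ t ∈ P, (t ∩ S).card = 1 ∧ (t ∩ K).card = 2) ∧
      (K.card : ℝ) / 2 * min (S.card : ℝ) ((K.card : ℝ) - 1) ≤ (P.card : ℝ) := by
  classical
  rcases K.eq_empty_or_nonempty with rfl | hne
  · exact ⟨∅, by simp [IsTrianglePacking], by simp, by simp⟩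
  obtain ⟨f, hf, hinj⟩ := exists_one_factorization K hKeven hne
  obtain ⟨S', hS'S, hS'card⟩ := exists_subset_card_eq (min_le_left S.card (K.card - 1))
  obtain ⟨g⟩ : Nonempty (S' ↪ Fin (K.card - 1)) :=
    Function.Embedding.nonempty_of_card_le (by simp [hS'card])
  have hKS : ∀ x ∈ K, ∀ s ∈ S, x ≠ s := fun x hx s hs h =>
    Finset.disjoint_left.mp hdisj hx (h ▸ hs)
  let F : S' × K → Finset V := fun p => {p.1.1, p.2.1, f (g p.1) p.2.1}
  have hFK : ∀ p u, u ∈ F p → u ∈ K → u = p.2.1 ∨ u = f (g p.1) p.2.1 := by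
    intro p u hu huK
    have := hKS u huK p.1.1 (hS'S p.1.2)
    simpa [F, this] using hu
  have hFS : ∀ p u, u ∈ F p → u ∉ K → u = p.1.1 := by
    intro p u hu huK
    have h1 : u ≠ p.2.1 := fun h => huK (h ▸ p.2.2)
    have h2 : u ≠ f (g p.1) p.2.1 := fun h => huK (h ▸ (hf _ _ p.2.2).1)
    simpa [F, h1, h2] using hu
  have hpartner : ∀ p u v, u ∈ F p → v ∈ F p → u ∈ K → v ∈ K → u ≠ v → f (g p.1) u = v := by
    intro p u v hu hv huK hvK huv
    have := (hf (g p.1) _ p.2.2).2.2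
    rcases hFK p u hu huK with rfl | rfl <;> rcases hFK p v hv hvK with rfl | rfl <;> simp_all
  have hFeq : ∀ p q u, p.1 = q.1 → u ∈ F p → u ∈ F q → u ∈ K → F p = F q := by
    intro p q u hpq hu hv huK
    have key : ∀ r, u ∈ F r → F r = {r.1.1, u, f (g r.1) u} := by
      intro r hr
      rcases hFK r u hr huK with rfl | rfl
      · rfl
      · rw [(hf _ _ r.2.2).2.2]
        simp only [F]
        rw [Finset.pair_comm]
    rw [key p hu, key q hv, hpq]
  have hpack : ∀ p q, F p ≠ F q → (F p ∩ F q).card ≤ 1 := by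
    intro p q hpq
    rw [Finset.card_le_one]
    intro u hu v hv
    rw [Finset.mem_inter] at hu hv
    by_contra huv
    have hsame : p.1 = q.1 → False := by
      intro h
      by_cases huK : u ∈ K
      · exact hpq (hFeq p q u h hu.1 hu.2 huK)
      by_cases hvK : v ∈ K
      · exact hpq (hFeq p q v h hv.1 hv.2 hvK)
      exact huv ((hFS p u hu.1 huK).trans (hFS p v hv.1 hvK).symm)
    have hmem : ∀ w, w ∈ F p → w ∈ F q → w ∈ K := by
      intro w hp hq
      by_contra hw
      exact hsame (Subtype.ext ((hFS p w hp hw).symm.trans (hFS q w hq hw)))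
    have huK := hmem u hu.1 hu.2
    have hvK := hmem v hv.1 hv.2
    exact hsame (g.injective (hinj _ _ u huK
      ((hpartner p u v hu.1 hv.1 huK hvK huv).trans
        (hpartner q u v hu.2 hv.2 huK hvK huv).symm)))
  refine ⟨Finset.univ.image F, ⟨?_, ?_⟩, ?_, ?_⟩
  · simp only [Finset.mem_image, Finset.mem_univ, true_and, forall_exists_index,
      forall_apply_eq_imp_iff]
    rintro ⟨⟨s, hs⟩, ⟨x, hx⟩⟩
    obtain ⟨h1, h2, -⟩ := hf (g ⟨s, hs⟩) x hx
    rw [is3Clique_triple_iff]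
    exact ⟨(hcomp _ hx _ (hS'S hs)).symm, (hcomp _ h1 _ (hS'S hs)).symm, hK hx h1 h2.symm⟩
  · simp only [Finset.mem_image, Finset.mem_univ, true_and]
    rintro _ ⟨p, rfl⟩ _ ⟨q, rfl⟩ h
    exact hpack p q h
  · simp only [Finset.mem_image, Finset.mem_univ, true_and, forall_exists_index,
      forall_apply_eq_imp_iff]
    rintro ⟨⟨s, hs⟩, ⟨x, hx⟩⟩
    obtain ⟨h1, h2, -⟩ := hf (g ⟨s, hs⟩) x hx
    have hsS := hS'S hs
    have hsK : s ∉ K := fun h => hKS s h s hsS rfl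
    have hxS : x ∉ S := fun h => hKS x hx x h rfl
    have hyS : f (g ⟨s, hs⟩) x ∉ S := fun h => hKS _ h1 _ h rfl
    constructor
    · simp [F, Finset.insert_inter_of_mem, Finset.insert_inter_of_notMem,
        Finset.singleton_inter_of_notMem, hsS, hxS, hyS]
    · simp only [F]
      rw [Finset.insert_inter_of_notMem hsK, Finset.insert_inter_of_mem hx,
        Finset.singleton_inter_of_mem h1, Finset.card_pair h2.symm]
  · have hcard : (Finset.univ : Finset (S' × K)).card ≤ 2 * (Finset.univ.image F).card := by
      refine Finset.card_le_mul_card_image _ 2 ?_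
      simp only [Finset.mem_image, Finset.mem_univ, true_and, forall_exists_index,
        forall_apply_eq_imp_iff]
      intro p
      refine (Finset.card_le_card (t := {p, (p.1, ⟨_, (hf (g p.1) _ p.2.2).1⟩)}) ?_).trans
        Finset.card_le_two
      intro q hq
      simp only [Finset.mem_filter, Finset.mem_univ, true_and] at hq
      have hs : q.1 = p.1 := by
        refine Subtype.ext (hFS p _ (hq ▸ by simp [F]) fun h => ?_)
        exact hKS _ h _ (hS'S q.1.2) rfl
      simp only [Finset.mem_insert, Finset.mem_singleton]
      exact (hFK p q.2.1 (hq ▸ by simp [F]) q.2.2).imp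
        (fun h => Prod.ext hs (Subtype.ext h)) (fun h => Prod.ext hs (Subtype.ext h))
    rw [Finset.card_univ, Fintype.card_prod, Fintype.card_coe, Fintype.card_coe, hS'card]
      at hcard
    have hcast : ((min S.card (K.card - 1) : ℕ) : ℝ) = min (S.card : ℝ) ((K.card : ℝ) - 1) := by
      rw [Nat.cast_min, Nat.cast_sub hne.card_pos, Nat.cast_one]
    have hreal : ((min S.card (K.card - 1) : ℕ) : ℝ) * K.card
        ≤ 2 * (Finset.univ.image F).card := by
      exact_mod_cast hcard
    rw [← hcast]
    linarith
end

section
/- For every n ≥ 1, the maximum number ν(K_n) of pairwise edge-disjoint triangles in the complete graph K_n equals (1/3)·(C(n,2) − k), where k = 0 if n mod 6 ∈ {1,3}; k = 4 if n mod 6 = 5; k = n/2 if n mod 6 ∈ {0,2}; and k = n/2 + 1 if n mod 6 = 4. -/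
open Finset SimpleGraph

open scoped Finset

/-- A partial Steiner operation: `g a b` is the third point of the triple through the distinct
points `a` and `b` if there is one, and `g a b = a` otherwise. -/
structure IsPartialSteiner {V : Type*} (g : V → V → V) : Prop where
  idem : ∀ a, g a a = a
  comm : ∀ a b, g a b ≠ a → g b a = g a b
  invol : ∀ a b, g a b ≠ a → g a (g a b) = b
  ne_right : ∀ a b, g a b ≠ a → g a b ≠ b

namespace IsPartialSteiner

variable {V : Type*} {g g₁ g₂ : V → V → V}

theorem ne (h : IsPartialSteiner g) {a b : V} (hab : g a b ≠ a) : a ≠ b := by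
  rintro rfl
  exact hab (h.idem a)

theorem third (h : IsPartialSteiner g) {a b : V} (hab : g a b ≠ a) :
    g b (g a b) = a ∧ g (g a b) a = b ∧ g (g a b) b = a := by
  have hba : g b a ≠ b := by rw [h.comm a b hab]; exact h.ne_right a b hab
  have h1 : g b (g a b) = a := by rw [← h.comm a b hab]; exact h.invol b a hba
  have h2 : g a (g a b) ≠ a := by rw [h.invol a b hab]; exact (h.ne hab).symm
  have h3 : g b (g a b) ≠ b := by rw [h1]; exact h.ne hab
  refine ⟨h1, ?_, ?_⟩
  · rw [h.comm _ _ h2, h.invol a b hab]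
  · rw [h.comm _ _ h3, h1]

/-- Two partial Steiner operations defined on disjoint sets of pairs can be merged. -/
theorem merge [DecidableEq V] (h₁ : IsPartialSteiner g₁) (h₂ : IsPartialSteiner g₂)
    (hd : ∀ a b, g₁ a b ≠ a → g₂ a b = a) :
    IsPartialSteiner fun a b => if g₁ a b = a then g₂ a b else g₁ a b := by
  have key : ∀ a b, g₂ a b ≠ a → g₁ a b = a := fun a b => not_imp_comm.1 (hd a b)
  have covered : ∀ {g : V → V → V}, IsPartialSteiner g → ∀ a b, g a b ≠ a →
      g b a ≠ b ∧ g a (g a b) ≠ a := by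
    intro g h a b hab
    rw [h.comm a b hab, h.invol a b hab]
    exact ⟨h.ne_right a b hab, (h.ne hab).symm⟩
  refine ⟨fun a => ?_, fun a b => ?_, fun a b => ?_, fun a b => ?_⟩
  · simp [h₁.idem, h₂.idem]
  · by_cases h : g₁ a b = a
    · intro hab
      simp only [h, if_true] at hab ⊢
      rw [if_pos (key b a (covered h₂ a b hab).1), h₂.comm a b hab]
    · simp only [h, if_false]
      intro _
      rw [if_neg (covered h₁ a b h).1, h₁.comm a b h]
  · by_cases h : g₁ a b = a
    · intro hab
      simp only [h, if_true] at hab ⊢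
      rw [if_pos (key _ _ (covered h₂ a b hab).2), h₂.invol a b hab]
    · simp only [h, if_false]
      intro _
      rw [if_neg (covered h₁ a b h).2, h₁.invol a b h]
  · by_cases h : g₁ a b = a
    · simpa only [h, if_true] using h₂.ne_right a b
    · simpa only [h, if_false] using h₁.ne_right a b

end IsPartialSteiner

theorem zmod_three_cases (i j : ZMod 3) : i = j ∨ j = i + 1 ∨ i = j + 1 := by
  revert i j; decide

/-- The mixed triples `(i, x), (i, y), (i + 1, z)` with `x ≠ y` and `x + y = τ z`. -/
def mixedOp {A W : Type*} [AddCommGroup A] [DecidableEq A] (τ : A ≃ A) :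
    (ZMod 3 × A) ⊕ W → (ZMod 3 × A) ⊕ W → (ZMod 3 × A) ⊕ W
  | .inl (i, x), .inl (j, y) =>
    if i = j then (if x = y then .inl (i, x) else .inl (i + 1, τ.symm (x + y)))
    else if j = i + 1 then (if τ y = x + x then .inl (i, x) else .inl (i, τ y - x))
    else if τ x = y + y then .inl (i, x) else .inl (j, τ x - y)
  | a, _ => a

/-- The triples `(0, x), (1, x), (2, x)` for `x` satisfying `p`. -/
def verticalOp {A W : Type*} [DecidableEq A] (p : A → Prop) [DecidablePred p] :
    (ZMod 3 × A) ⊕ W → (ZMod 3 × A) ⊕ W → (ZMod 3 × A) ⊕ W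
  | .inl (i, x), .inl (j, y) =>
    if x = y ∧ i ≠ j ∧ p x then .inl (-(i + j), x) else .inl (i, x)
  | a, _ => a

theorem isPartialSteiner_verticalOp {A W : Type*} [DecidableEq A] (p : A → Prop)
    [DecidablePred p] : IsPartialSteiner (verticalOp (W := W) p) := by
  have h3 : ∀ i j : ZMod 3, i ≠ j → -(i + j) ≠ i ∧ -(i + j) ≠ j ∧ -(i + -(i + j)) = j := by
    decide
  constructor
  · rintro (⟨i, x⟩ | w) <;> simp [verticalOp]
  all_goals
    rintro (⟨i, x⟩ | w) (⟨j, y⟩ | w') <;> simp only [verticalOp] <;> grind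

theorem isPartialSteiner_mixedOp {A W : Type*} [AddCommGroup A] [DecidableEq A] (τ : A ≃ A) :
    IsPartialSteiner (mixedOp (W := W) τ) := by
  have h1 : ∀ i : ZMod 3, i + 1 ≠ i := by decide
  have h2 : ∀ i : ZMod 3, i ≠ i + 1 + 1 := by decide
  have same : ∀ i x y, mixedOp (W := W) τ (.inl (i, x)) (.inl (i, y)) =
      if x = y then .inl (i, x) else .inl (i + 1, τ.symm (x + y)) := by simp [mixedOp]
  have up : ∀ i x y, mixedOp (W := W) τ (.inl (i, x)) (.inl (i + 1, y)) =
      if τ y = x + x then .inl (i, x) else .inl (i, τ y - x) := by simp [mixedOp]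
  have down : ∀ i x y, mixedOp (W := W) τ (.inl (i + 1, x)) (.inl (i, y)) =
      if τ x = y + y then .inl (i + 1, x) else .inl (i, τ x - y) := by simp [mixedOp, h1, h2]
  constructor
  · rintro (⟨i, x⟩ | w) <;> simp [mixedOp]
  all_goals
    rintro (⟨i, x⟩ | w) (⟨j, y⟩ | w')
    · rcases zmod_three_cases i j with rfl | rfl | rfl <;> simp only [same, up, down] <;>
        split_ifs <;>
        (try simp only [same, up, down, Equiv.apply_symm_apply, add_sub_cancel_left,
          add_sub_cancel, add_right_inj, sub_sub_cancel]) <;>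
        clear same up down <;>
        grind [add_comm, sub_add_cancel, Equiv.symm_apply_apply]
    all_goals simp [mixedOp]

theorem IsPartialSteiner.exists_isTrianglePacking {V : Type*} [Fintype V] [DecidableEq V]
    {g : V → V → V} (h : IsPartialSteiner g) (B : Finset (V × V))
    (hB : ∀ a b, a ≠ b → g a b = a → (a, b) ∈ B) :
    ∃ P, IsTrianglePacking (⊤ : SimpleGraph V) P ∧
      Fintype.card V * Fintype.card V ≤ 6 * #P + Fintype.card V + #B := by
  let C : Finset (V × V) := {p | g p.1 p.2 ≠ p.1}
  let f : V × V → Finset V := fun p => {p.1, p.2, g p.1 p.2}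
  have hC : ∀ {p}, p ∈ C ↔ g p.1 p.2 ≠ p.1 := by simp [C]
  have line : ∀ p ∈ C, ∀ a ∈ f p, ∀ b ∈ f p, a ≠ b → (a, b) ∈ C ∧ f (a, b) = f p := by
    rintro ⟨x, y⟩ hp a ha b hb hab
    rw [hC] at hp
    dsimp only at hp
    have h1 := h.third hp
    have h2 := h.comm x y hp
    have h3 := h.invol x y hp
    have h4 := h.ne_right x y hp
    have h5 := h.ne hp
    simp only [f, mem_insert, mem_singleton] at ha hb
    rw [hC]
    simp only [f]
    obtain rfl | rfl | rfl := ha <;> obtain rfl | rfl | rfl := hb <;>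
      first
      | exact absurd rfl hab
      | exact ⟨by grind, by ext z; simp only [mem_insert, mem_singleton] <;> grind⟩
  have hcard : ∀ p ∈ C, #(f p) = 3 := by
    intro p hp
    rw [hC] at hp
    exact card_eq_three.2 ⟨_, _, _, h.ne hp, hp.symm, (h.ne_right _ _ hp).symm, rfl⟩
  refine ⟨C.image f, ⟨?_, ?_⟩, ?_⟩
  · intro t ht
    obtain ⟨p, hp, rfl⟩ := mem_image.1 ht
    exact ⟨fun a _ b _ hab => hab, hcard p hp⟩
  · intro t₁ h₁ t₂ h₂ hne
    obtain ⟨p, hp, rfl⟩ := mem_image.1 h₁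
    obtain ⟨q, hq, rfl⟩ := mem_image.1 h₂
    by_contra! hlt
    obtain ⟨a, ha, b, hb, hab⟩ := one_lt_card.1 hlt
    rw [mem_inter] at ha hb
    exact hne ((line p hp a ha.1 b hb.1 hab).2.symm.trans (line q hq a ha.2 b hb.2 hab).2)
  · have hfib : ∀ t ∈ C.image f, #{p ∈ C | f p = t} = 6 := by
      intro t ht
      obtain ⟨p, hp, rfl⟩ := mem_image.1 ht
      have : ({q ∈ C | f q = f p} : Finset (V × V)) = (f p).offDiag := by
        ext ⟨a, b⟩
        simp only [mem_filter, mem_offDiag]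
        constructor
        · rintro ⟨hab, hf⟩
          rw [← hf]
          exact ⟨by simp [f], by simp [f], h.ne (hC.1 hab)⟩
        · rintro ⟨ha, hb, hab⟩
          exact line p hp a ha b hb hab
      rw [this, offDiag_card, hcard p hp]
    have hsum : #C = #(C.image f) * 6 := by
      rw [card_eq_sum_card_image f C, sum_const_nat hfib]
    have hcover : (univ : Finset (V × V)) ⊆ C ∪ univ.diag ∪ B := by
      rintro ⟨a, b⟩ -
      by_cases hab : a = b
      · simp [hab]
      · by_cases hg : g a b = a
        · simp [hB a b hab hg]
        · simp [hC, hg]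
    have := card_le_card hcover
    have h1 := card_union_le (C ∪ univ.diag) B
    have h2 := card_union_le C univ.diag
    rw [diag_card] at h2
    simp only [card_univ, Fintype.card_prod] at this h2
    omega

/-- Pull back a triangle packing along an injection. -/
theorem IsTrianglePacking.comap {V W : Type*} [Fintype V] [Fintype W] [DecidableEq V]
    [DecidableEq W] {P : Finset (Finset V)} (hP : IsTrianglePacking (⊤ : SimpleGraph V) P)
    (f : W ↪ V) :
    ∃ Q, IsTrianglePacking (⊤ : SimpleGraph W) Q ∧ #Q = #{t ∈ P | ∀ x ∈ t, x ∈ Set.range f} := by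
  refine ⟨univ.filter fun t : Finset W => t.map f ∈ P, ⟨?_, ?_⟩, ?_⟩
  · intro t ht
    refine ⟨fun a _ b _ hab => hab, ?_⟩
    rw [← card_map f]
    exact (hP.1 _ (by simpa using ht)).card_eq
  · intro t₁ h₁ t₂ h₂ hne
    rw [← card_map f, map_inter]
    exact hP.2 _ (by simpa using h₁) _ (by simpa using h₂) (by simpa using hne)
  · rw [← card_map (mapEmbedding f).toEmbedding]
    congr 1
    ext t
    simp only [mem_map, mem_filter, mem_univ, true_and, RelEmbedding.coe_toEmbedding,
      mapEmbedding_apply]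
    constructor
    · rintro ⟨s, hs, rfl⟩
      exact ⟨hs, by simp⟩
    · rintro ⟨ht, hr⟩
      obtain ⟨s, -, rfl⟩ := subset_map_iff.1 (show t ⊆ (univ : Finset W).map f from
        fun x hx => by simpa using hr x hx)
      exact ⟨s, ht, rfl⟩

section Degree

variable {V : Type*} [Fintype V] [DecidableEq V] {P : Finset (Finset V)}

theorem sum_card_filter_mem (hP : IsTrianglePacking (⊤ : SimpleGraph V) P) :
    ∑ v, #{t ∈ P | v ∈ t} = 3 * #P := by
  have := sum_card_bipartiteAbove_eq_sum_card_bipartiteBelow (s := univ) (t := P)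
    fun (v : V) (t : Finset V) => v ∈ t
  simp only [bipartiteAbove] at this
  rw [this, mul_comm]
  refine sum_const_nat fun t ht => ?_
  rw [← (hP.1 t ht).card_eq]
  simp [bipartiteBelow]

theorem card_neighbors (hP : IsTrianglePacking (⊤ : SimpleGraph V) P) (v : V) :
    #({u | u ≠ v ∧ ∃ t ∈ P, v ∈ t ∧ u ∈ t}) = 2 * #{t ∈ P | v ∈ t} := by
  have : ({u | u ≠ v ∧ ∃ t ∈ P, v ∈ t ∧ u ∈ t} : Finset V) =
      ({t ∈ P | v ∈ t} : Finset _).biUnion fun t => t.erase v := by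
    ext u
    simp only [mem_filter, mem_univ, true_and, mem_biUnion, mem_erase]
    grind
  rw [this, card_biUnion, mul_comm]
  · refine sum_const_nat fun t ht => ?_
    rw [mem_filter] at ht
    rw [card_erase_of_mem ht.2, (hP.1 t ht.1).card_eq]
  · intro s hs t ht hst
    rw [mem_coe, mem_filter] at hs ht
    rw [Function.onFun, Finset.disjoint_left]
    intro u hu hu'
    rw [mem_erase] at hu hu'
    have := hP.2 s hs.1 t ht.1 hst
    rw [card_le_one] at this
    exact hu.1 (this u (by simp [hu.2, hu'.2]) v (by simp [hs.2, ht.2]))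

theorem two_mul_card_filter_mem_lt (hP : IsTrianglePacking (⊤ : SimpleGraph V) P) (v : V) :
    2 * #{t ∈ P | v ∈ t} < Fintype.card V := by
  rw [← card_neighbors hP, ← card_univ]
  exact card_lt_card (filter_ssubset.2 ⟨v, mem_univ v, by simp⟩)

/-- A vertex with an uncovered edge is joined by it to another such vertex. -/
theorem exists_ne_two_mul_card_filter_mem_lt (hP : IsTrianglePacking (⊤ : SimpleGraph V) P)
    {v : V} (hv : 2 * #{t ∈ P | v ∈ t} + 1 < Fintype.card V) :
    ∃ u ≠ v, 2 * #{t ∈ P | u ∈ t} + 1 < Fintype.card V := by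
  rw [← card_neighbors hP] at hv
  have : ∃ u, u ∉ insert v ({u | u ≠ v ∧ ∃ t ∈ P, v ∈ t ∧ u ∈ t} : Finset V) := by
    by_contra! hall
    have h1 := card_insert_le v ({u | u ≠ v ∧ ∃ t ∈ P, v ∈ t ∧ u ∈ t} : Finset V)
    rw [eq_univ_iff_forall.2 hall, card_univ] at h1
    omega
  obtain ⟨u, hu⟩ := this
  simp only [mem_insert, mem_filter, mem_univ, true_and, not_or, not_and] at hu
  refine ⟨u, hu.1, ?_⟩
  rw [← card_neighbors hP, ← card_univ]
  have hdisj : Disjoint ({w | w ≠ u ∧ ∃ t ∈ P, u ∈ t ∧ w ∈ t} : Finset V) {u} := by simp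
  rw [← card_singleton u, ← card_union_of_disjoint hdisj]
  refine card_lt_card ((ssubset_univ_iff).2 fun h => ?_)
  have hvm := h ▸ mem_univ v
  simp only [mem_union, mem_filter, mem_univ, true_and, mem_singleton] at hvm
  grind

theorem three_mul_card_le (hP : IsTrianglePacking (⊤ : SimpleGraph V) P) {d : ℕ}
    (hd : Fintype.card V ≤ 2 * d + 2) : 3 * #P ≤ Fintype.card V * d := by
  rw [← sum_card_filter_mem hP, ← card_univ, ← smul_eq_mul]
  refine sum_le_card_nsmul _ _ _ fun v _ => ?_
  have := two_mul_card_filter_mem_lt hP v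
  omega

theorem three_mul_card_add_two_le (hP : IsTrianglePacking (⊤ : SimpleGraph V) P) {d : ℕ}
    (hd : Fintype.card V = 2 * d + 1) (hne : 3 * #P ≠ Fintype.card V * d) :
    3 * #P + 2 ≤ Fintype.card V * d := by
  have hle : ∀ v, #{t ∈ P | v ∈ t} ≤ d := fun v => by
    have := two_mul_card_filter_mem_lt hP v
    omega
  have hex : ∃ v, #{t ∈ P | v ∈ t} < d := by
    by_contra! h
    refine hne ?_
    rw [← sum_card_filter_mem hP, ← card_univ]
    exact sum_const_nat fun v _ => le_antisymm (hle v) (h v)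
  obtain ⟨v, hv⟩ := hex
  obtain ⟨u, huv, hu⟩ := exists_ne_two_mul_card_filter_mem_lt hP (v := v) (by omega)
  have hsum := sum_card_filter_mem hP
  rw [← add_sum_erase _ _ (mem_univ v),
    ← add_sum_erase _ _ (mem_erase.2 ⟨huv, mem_univ u⟩)] at hsum
  have hrest := sum_le_card_nsmul ((univ.erase v).erase u) (fun w => #{t ∈ P | w ∈ t}) d
    fun w _ => hle w
  rw [card_erase_of_mem (mem_erase.2 ⟨huv, mem_univ u⟩), card_erase_of_mem (mem_univ v),
    card_univ, smul_eq_mul] at hrest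
  have hc : 1 < Fintype.card V := Fintype.one_lt_card_iff.2 ⟨u, v, huv⟩
  obtain ⟨c, hc⟩ : ∃ c, Fintype.card V = c + 2 := ⟨_, (Nat.sub_add_cancel hc).symm⟩
  rw [hc] at hrest ⊢
  rw [show c + 2 - 1 - 1 = c by omega] at hrest
  rw [add_mul]
  omega

end Degree

/-- Deleting a vertex of minimum degree. -/
theorem IsTrianglePacking.exists_pred {n : ℕ} {P : Finset (Finset (Fin (n + 1)))}
    (hP : IsTrianglePacking (⊤ : SimpleGraph (Fin (n + 1))) P) :
    ∃ Q, IsTrianglePacking (⊤ : SimpleGraph (Fin n)) Q ∧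
      (n + 1) * #P ≤ (n + 1) * #Q + 3 * #P := by
  have hsum := sum_card_filter_mem hP
  obtain ⟨v, -, hv⟩ := exists_le_of_sum_le (s := univ)
    (f := fun v => (n + 1) * #{t ∈ P | v ∈ t}) (g := fun _ => 3 * #P) univ_nonempty (by
      rw [← mul_sum, hsum]; simp)
  obtain ⟨Q, hQ, hcard⟩ := hP.comap (Fin.succAboveEmb v)
  refine ⟨Q, hQ, ?_⟩
  have : #P = #{t ∈ P | v ∈ t} + #Q := by
    rw [hcard, ← card_filter_add_card_filter_not (fun t => v ∈ t)]
    congr 2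
    ext t
    simp only [mem_filter, and_congr_right_iff]
    intro _
    simp
  nlinarith

theorem nu_eq_of_isTrianglePacking {V : Type*} [Fintype V] [DecidableEq V] {G : SimpleGraph V}
    {P : Finset (Finset V)} (hP : IsTrianglePacking G P)
    (hmax : ∀ Q, IsTrianglePacking G Q → #Q ≤ #P) : nu G = #P :=
  IsGreatest.csSup_eq ⟨⟨P, hP, rfl⟩, by rintro _ ⟨Q, hQ, rfl⟩; exact hmax Q hQ⟩

/-- The triples `∞, (i, x), (i + 1, φ x)` for `x` satisfying `p`, where `∞` is the point `w`. -/
def coneOp {A W : Type*} [DecidableEq A] [DecidableEq W] (φ : A → A) (p : A → Prop)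
    [DecidablePred p] (w : W) :
    (ZMod 3 × A) ⊕ W → (ZMod 3 × A) ⊕ W → (ZMod 3 × A) ⊕ W
  | .inl (i, x), .inl (j, y) =>
    if y = φ x ∧ (j = i + 1 ∧ p x ∨ i = j + 1 ∧ p y) then .inr w else .inl (i, x)
  | .inl (i, x), .inr v =>
    if v = w ∧ p x then .inl (i + 1, φ x)
    else if v = w ∧ p (φ x) then .inl (i - 1, φ x)
    else .inl (i, x)
  | .inr v, .inl (i, x) =>
    if v = w ∧ p x then .inl (i + 1, φ x)
    else if v = w ∧ p (φ x) then .inl (i - 1, φ x)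
    else .inr v
  | .inr v, .inr _ => .inr v

theorem isPartialSteiner_coneOp {A W : Type*} [DecidableEq A] [DecidableEq W] {φ : A → A}
    (hφ : ∀ x, φ (φ x) = x) {p : A → Prop} [DecidablePred p] (hp : ∀ x, p x → ¬ p (φ x))
    (w : W) : IsPartialSteiner (coneOp φ p w) := by
  have h1 : ∀ i : ZMod 3, i + 1 ≠ i := by decide
  have h2 : ∀ i : ZMod 3, i - 1 ≠ i := by decide
  have h3 : ∀ i j : ZMod 3, j = i + 1 → i ≠ j + 1 := by decide
  have h4 : ∀ i j : ZMod 3, i = j - 1 ↔ j = i + 1 := by decide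
  constructor
  · rintro (⟨i, x⟩ | v) <;> simp [coneOp]
  · rintro (⟨i, x⟩ | v) (⟨j, y⟩ | v') <;> simp only [coneOp] <;> grind
  · rintro (⟨i, x⟩ | v) (⟨j, y⟩ | v') <;> simp only [coneOp] <;> (try split_ifs) <;>
      (try simp only) <;> grind
  · rintro (⟨i, x⟩ | v) (⟨j, y⟩ | v') <;> simp only [coneOp] <;> grind

/-- The single triple `a, b, c`. -/
def singleOp {V : Type*} [DecidableEq V] (a b c x y : V) : V :=
  if x = a ∧ y = b ∨ x = b ∧ y = a then c
  else if x = a ∧ y = c ∨ x = c ∧ y = a then b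
  else if x = b ∧ y = c ∨ x = c ∧ y = b then a
  else x

theorem isPartialSteiner_singleOp {V : Type*} [DecidableEq V] {a b c : V} (hab : a ≠ b)
    (hac : a ≠ c) (hbc : b ≠ c) : IsPartialSteiner (singleOp a b c) := by
  constructor <;> intros <;> grind [singleOp]

theorem exists_isTrianglePacking_of_double {A : Type*} [Fintype A] [AddCommGroup A]
    [DecidableEq A] (hA : ∀ x y : A, x + x = y + y → x = y) :
    ∃ P, IsTrianglePacking (⊤ : SimpleGraph ((ZMod 3 × A) ⊕ Empty)) P ∧
      Fintype.card ((ZMod 3 × A) ⊕ Empty) * Fintype.card ((ZMod 3 × A) ⊕ Empty) ≤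
        6 * #P + Fintype.card ((ZMod 3 × A) ⊕ Empty) := by
  let τ : A ≃ A := .ofBijective (fun x => x + x) (Finite.injective_iff_bijective.1 hA)
  have hτ : ∀ x, τ x = x + x := fun _ => rfl
  have h2 : ∀ j : ZMod 3, j + 1 + 1 ≠ j := by decide
  have h := (isPartialSteiner_mixedOp (W := Empty) τ).merge
    (isPartialSteiner_verticalOp fun _ => True) (by
      rintro (⟨i, x⟩ | ⟨⟨⟩⟩) (⟨j, y⟩ | ⟨⟨⟩⟩)
      simp only [mixedOp, verticalOp, hτ]
      grind)
  refine h.exists_isTrianglePacking ∅ ?_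
  have h1 : ∀ i : ZMod 3, i + 1 ≠ i := by decide
  have h4 : ∀ i j : ZMod 3, i ≠ j → -(i + j) ≠ i := by decide
  rintro (⟨i, x⟩ | ⟨⟨⟩⟩) (⟨j, y⟩ | ⟨⟨⟩⟩)
  rcases zmod_three_cases i j with rfl | rfl | rfl <;>
    simp only [mixedOp, verticalOp] <;> grind

theorem exists_isTrianglePacking_of_half {A : Type*} [Fintype A] [AddCommGroup A]
    [DecidableEq A] {H : A → Prop} [DecidablePred H] {κ : A} (hκ : κ + κ = 0)
    (hH : ∀ x, H (x + κ) ↔ ¬ H x) (hA : ∀ x y, H x → H y → x + x = y + y → x = y) :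
    ∃ P, IsTrianglePacking (⊤ : SimpleGraph ((ZMod 3 × A) ⊕ Unit)) P ∧
      Fintype.card ((ZMod 3 × A) ⊕ Unit) * Fintype.card ((ZMod 3 × A) ⊕ Unit) ≤
        6 * #P + Fintype.card ((ZMod 3 × A) ⊕ Unit) := by
  obtain ⟨τ, hτ⟩ : ∃ τ : A ≃ A, ∀ x, H x → τ x = x + x := by
    obtain ⟨g, hg⟩ := exists_equiv_extend_of_card_eq (t := (univ : Finset A)) (s := {x | H x})
      (f := fun x => x + x) rfl (subset_univ _) (by
        intro x hx y hy hxy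
        exact hA x y (by simpa using hx) (by simpa using hy) hxy)
    exact ⟨g.trans (Equiv.subtypeUnivEquiv mem_univ), fun x hx => hg x (by simpa using hx)⟩
  have hφ : ∀ x, x + κ + κ = x := fun x => by rw [add_assoc, hκ, add_zero]
  have hτκ : ∀ x, ¬ H x → τ (x + κ) = x + x := fun x hx => by
    rw [hτ _ ((hH x).2 hx), add_add_add_comm, hκ, add_zero]
  have h1 : ∀ i : ZMod 3, i + 1 ≠ i := by decide
  have h2 : ∀ i : ZMod 3, i ≠ i + 1 + 1 := by decide
  have h4 : ∀ i j : ZMod 3, i ≠ j → -(i + j) ≠ i := by decide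
  have hcover : ∀ x y, τ y = x + x → H x ∧ y = x ∨ ¬ H x ∧ y = x + κ := by
    intro x y hxy
    by_cases hx : H x
    · exact .inl ⟨hx, τ.injective (by rw [hxy, hτ x hx])⟩
    · exact .inr ⟨hx, τ.injective (by rw [hxy, hτκ x hx])⟩
  have h := ((isPartialSteiner_mixedOp (W := Unit) τ).merge
    (isPartialSteiner_verticalOp H) (by
      rintro (⟨i, x⟩ | w) (⟨j, y⟩ | w')
      · rcases zmod_three_cases i j with rfl | rfl | rfl <;>
          simp only [mixedOp, verticalOp] <;> grind
      all_goals simp [mixedOp, verticalOp])).merge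
    (isPartialSteiner_coneOp (φ := (· + κ)) hφ (p := fun x => ¬ H x) (by grind) ()) (by
      rintro (⟨i, x⟩ | w) (⟨j, y⟩ | w')
      · rcases zmod_three_cases i j with rfl | rfl | rfl <;>
          simp only [mixedOp, verticalOp, coneOp] <;> grind
      all_goals simp [mixedOp, verticalOp])
  refine h.exists_isTrianglePacking ∅ ?_
  rintro (⟨i, x⟩ | w) (⟨j, y⟩ | w')
  · rcases zmod_three_cases i j with rfl | rfl | rfl <;>
      simp only [mixedOp, verticalOp, coneOp] <;> grind
  all_goals
    simp only [mixedOp, verticalOp, coneOp]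
    grind

theorem exists_isTrianglePacking_of_sign {A : Type*} [Fintype A] [AddCommGroup A]
    [DecidableEq A] (hA : ∀ x y : A, x + x = y + y → x = y) {s : A → Prop} [DecidablePred s]
    (hs : ∀ x, s x → ¬ s (-x)) (hs' : ∀ x, x ≠ 0 → s x ∨ s (-x)) :
    ∃ P, IsTrianglePacking (⊤ : SimpleGraph ((ZMod 3 × A) ⊕ Bool)) P ∧
      Fintype.card ((ZMod 3 × A) ⊕ Bool) * Fintype.card ((ZMod 3 × A) ⊕ Bool) ≤
        6 * #P + Fintype.card ((ZMod 3 × A) ⊕ Bool) + 8 := by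
  let τ : A ≃ A := .ofBijective (fun x => -(x + x)) (Finite.injective_iff_bijective.1
    fun x y hxy => hA x y (neg_injective hxy))
  have hτ : ∀ x y, τ y = x + x ↔ y = -x := by
    refine fun x y => ⟨fun hxy => ?_, ?_⟩
    · refine hA _ _ ?_
      rw [← neg_add, ← hxy]
      exact (neg_neg _).symm
    · rintro rfl
      simp [τ]
  clear_value τ
  have hs0 : ¬ s 0 := fun h => hs 0 h (by simpa using h)
  have h1 : ∀ i : ZMod 3, i + 1 ≠ i := by decide
  have h2 : ∀ i : ZMod 3, i ≠ i + 1 + 1 := by decide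
  have h3 : ∀ i : ZMod 3, i - 1 ≠ i := by decide
  have h4 : ∀ i j : ZMod 3, i ≠ j → -(i + j) ≠ i := by decide
  have hs'' : ∀ x, s (-x) → ¬ s x := fun x hx hx' => hs x hx' hx
  have h := ((((isPartialSteiner_mixedOp (W := Bool) τ).merge
    (isPartialSteiner_verticalOp (· = 0)) (by
      rintro (⟨i, x⟩ | w) (⟨j, y⟩ | w')
      · rcases zmod_three_cases i j with rfl | rfl | rfl <;>
          simp only [mixedOp, verticalOp] <;> grind
      all_goals simp [mixedOp, verticalOp])).merge
    (isPartialSteiner_coneOp neg_neg hs true) (by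
      rintro (⟨i, x⟩ | w) (⟨j, y⟩ | w')
      · rcases zmod_three_cases i j with rfl | rfl | rfl <;>
          simp only [mixedOp, verticalOp, coneOp] <;> grind
      all_goals simp [mixedOp, verticalOp])).merge
    (isPartialSteiner_coneOp neg_neg (p := fun x => s (-x)) (by grind) false) (by
      rintro (⟨i, x⟩ | w) (⟨j, y⟩ | w')
      · rcases zmod_three_cases i j with rfl | rfl | rfl <;>
          simp only [mixedOp, verticalOp, coneOp] <;> grind
      all_goals
        simp only [mixedOp, verticalOp, coneOp]
        grind)).merge
    (isPartialSteiner_singleOp (a := .inr true) (b := .inr false) (c := .inl (0, 0))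
      (by simp) (by simp) (by simp)) (by
      rintro (⟨i, x⟩ | w) (⟨j, y⟩ | w')
      all_goals
        simp only [mixedOp, verticalOp, coneOp, singleOp]
        grind [neg_zero])
  let e : Bool × Bool × Bool → ((ZMod 3 × A) ⊕ Bool) × ((ZMod 3 × A) ⊕ Bool) := fun q =>
    if q.1 then (.inl (if q.2.1 then 1 else 2, 0), .inr q.2.2)
    else (.inr q.2.2, .inl (if q.2.1 then 1 else 2, 0))
  have he : ∀ i : ZMod 3, i ≠ 0 → ∀ w : Bool,
      (.inl (i, 0), .inr w) ∈ univ.image e ∧ (.inr w, .inl (i, 0)) ∈ univ.image e := by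
    intro i hi w
    have hi' : (if i = 1 then 1 else 2) = i := by revert i; decide
    exact ⟨mem_image.2 ⟨(true, decide (i = 1), w), mem_univ _, by simp [e, hi']⟩,
      mem_image.2 ⟨(false, decide (i = 1), w), mem_univ _, by simp [e, hi']⟩⟩
  have hB : #(univ.image e) ≤ 8 := card_image_le
  obtain ⟨P, hP, hcard⟩ := h.exists_isTrianglePacking (univ.image e) (by
    rintro (⟨i, x⟩ | w) (⟨j, y⟩ | w')
    · clear he
      rcases zmod_three_cases i j with rfl | rfl | rfl <;>
        simp only [mixedOp, verticalOp, coneOp, singleOp] <;> grind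
    · intro _ hg
      obtain rfl : x = 0 := by
        by_contra hx
        rcases hs' x hx with h | h <;> cases w' <;>
          simp [mixedOp, verticalOp, coneOp, h, hs, h1, h3, hs''] at hg
      refine (he i ?_ w').1
      rintro rfl
      cases w' <;> simp [mixedOp, verticalOp, coneOp, singleOp, hs0] at hg
    · intro _ hg
      obtain rfl : y = 0 := by
        by_contra hy
        rcases hs' y hy with h | h <;> cases w <;>
          simp [mixedOp, verticalOp, coneOp, h, hs, hs''] at hg
      refine (he j ?_ w).2
      rintro rfl
      cases w <;> simp [mixedOp, verticalOp, coneOp, singleOp, hs0] at hg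
    · cases w <;> cases w' <;> simp [mixedOp, verticalOp, coneOp, singleOp])
  exact ⟨P, hP, by omega⟩

theorem IsTrianglePacking.exists_fin {V : Type*} [Fintype V] [DecidableEq V] {n : ℕ}
    (hn : Fintype.card V = n) {P : Finset (Finset V)}
    (hP : IsTrianglePacking (⊤ : SimpleGraph V) P) :
    ∃ Q, IsTrianglePacking (⊤ : SimpleGraph (Fin n)) Q ∧ #Q = #P := by
  obtain ⟨Q, hQ, hcard⟩ := hP.comap (Fintype.equivFinOfCardEq hn).symm.toEmbedding
  refine ⟨Q, hQ, by rw [hcard, filter_true_of_mem]; simp⟩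

theorem ZMod.eq_of_add_self_eq {k : ℕ} {x y : ZMod (2 * k + 1)} (h : x + x = y + y) :
    x = y := by
  have h0 : (2 * k + 1 : ZMod (2 * k + 1)) = 0 := by
    exact_mod_cast ZMod.natCast_self (2 * k + 1)
  linear_combination (k + 1 : ZMod (2 * k + 1)) * h - (x - y) * h0

/-- Steiner triple systems on `n` points exist for `n ≡ 1, 3 (mod 6)`. -/
theorem exists_isTrianglePacking_of_mod_six {n : ℕ} (hn : n % 6 = 1 ∨ n % 6 = 3) :
    ∃ P, IsTrianglePacking (⊤ : SimpleGraph (Fin n)) P ∧ n * n ≤ 6 * #P + n := by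
  obtain ⟨k, rfl | rfl⟩ : ∃ k, n = 6 * k + 1 ∨ n = 6 * k + 3 := ⟨n / 6, by omega⟩
  · rcases Nat.eq_zero_or_pos k with rfl | hk
    · exact ⟨∅, by simp [IsTrianglePacking], by simp⟩
    have : NeZero (2 * k) := ⟨by omega⟩
    have hval : (k : ZMod (2 * k)).val = k := ZMod.val_natCast_of_lt (by omega)
    obtain ⟨P, hP, hcard⟩ := exists_isTrianglePacking_of_half
      (H := fun x : ZMod (2 * k) => x.val < k) (κ := (k : ZMod (2 * k)))
      (by
        have := ZMod.natCast_self (2 * k)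
        push_cast at this
        rw [← two_mul, this])
      (fun x => by
        have := x.val_lt
        rw [ZMod.val_add, hval]
        rcases lt_or_ge x.val k with h | h
        · rw [Nat.mod_eq_of_lt (by omega)]
          omega
        · rw [Nat.mod_eq_sub_mod (by omega), Nat.mod_eq_of_lt (by omega)]
          omega)
      (fun x y hx hy h => ZMod.val_injective _ (by
        have := congrArg ZMod.val h
        rw [ZMod.val_add_of_lt (by omega), ZMod.val_add_of_lt (by omega)] at this
        omega))
    have hV : Fintype.card ((ZMod 3 × ZMod (2 * k)) ⊕ Unit) = 6 * k + 1 := by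
      simp [ZMod.card]
      ring
    obtain ⟨Q, hQ, hQP⟩ := hP.exists_fin hV
    exact ⟨Q, hQ, by rwa [hQP, ← hV]⟩
  · obtain ⟨P, hP, hcard⟩ := exists_isTrianglePacking_of_double (A := ZMod (2 * k + 1))
      (fun _ _ => ZMod.eq_of_add_self_eq)
    have hV : Fintype.card ((ZMod 3 × ZMod (2 * k + 1)) ⊕ Empty) = 6 * k + 3 := by
      simp [ZMod.card]
      ring
    obtain ⟨Q, hQ, hQP⟩ := hP.exists_fin hV
    exact ⟨Q, hQ, by rwa [hQP, ← hV]⟩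

theorem exists_isTrianglePacking_of_mod_six_eq_five {n : ℕ} (hn : n % 6 = 5) :
    ∃ P, IsTrianglePacking (⊤ : SimpleGraph (Fin n)) P ∧ n * n ≤ 6 * #P + n + 8 := by
  obtain ⟨k, rfl⟩ : ∃ k, n = 6 * k + 5 := ⟨n / 6, by omega⟩
  obtain ⟨P, hP, hcard⟩ := exists_isTrianglePacking_of_sign (A := ZMod (2 * k + 1))
    (fun _ _ => ZMod.eq_of_add_self_eq) (s := fun x => x ≠ 0 ∧ x.val ≤ k)
    (fun x ⟨hx, hxk⟩ ⟨_, hxk'⟩ => by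
      have : NeZero x := ⟨hx⟩
      rw [ZMod.val_neg_of_ne_zero] at hxk'
      omega)
    (fun x hx => by
      have : NeZero x := ⟨hx⟩
      rw [ZMod.val_neg_of_ne_zero, neg_ne_zero]
      rcases le_or_gt x.val k with h | h
      · exact .inl ⟨hx, h⟩
      · exact .inr ⟨hx, by omega⟩)
  have hV : Fintype.card ((ZMod 3 × ZMod (2 * k + 1)) ⊕ Bool) = 6 * k + 5 := by
    simp [ZMod.card]
    ring
  obtain ⟨Q, hQ, hQP⟩ := hP.exists_fin hV
  exact ⟨Q, hQ, by rwa [hQP, ← hV]⟩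

/-- The number of edges of `K_n` left uncovered by a maximum triangle packing. -/
def leave (n : ℕ) : ℕ :=
  if n % 6 = 1 ∨ n % 6 = 3 then 0
  else if n % 6 = 5 then 4
  else if n % 6 = 4 then n / 2 + 1
  else n / 2

theorem six_mul_card_add_le {n : ℕ} {P : Finset (Finset (Fin n))}
    (hP : IsTrianglePacking (⊤ : SimpleGraph (Fin n)) P) :
    6 * #P + 2 * leave n + n ≤ n * n := by
  have hcard := Fintype.card_fin n
  obtain ⟨d, rfl | rfl⟩ : ∃ d, n = 2 * d + 1 ∨ n = 2 * d := ⟨n / 2, by omega⟩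
  · have hle := three_mul_card_le hP (d := d) (by omega)
    rw [hcard] at hle
    by_cases h5 : (2 * d + 1) % 6 = 5
    · obtain ⟨k, rfl⟩ : ∃ k, d = 3 * k + 2 := ⟨d / 3, by omega⟩
      have hlt := three_mul_card_add_two_le hP hcard (by rw [hcard]; ring_nf; omega)
      have hleave : leave (2 * (3 * k + 2) + 1) = 4 := by simp only [leave]; grind
      rw [hcard] at hlt
      rw [hleave]
      ring_nf at hlt ⊢
      omega
    · have hleave : leave (2 * d + 1) = 0 := by simp only [leave]; grind
      rw [hleave]
      linarith
  · rcases d with - | d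
    · have := three_mul_card_le hP (d := 0) (by omega)
      simp [leave] at this ⊢
      exact this
    have hle := three_mul_card_le hP (d := d) (by omega)
    rw [hcard] at hle
    by_cases h4 : (2 * (d + 1)) % 6 = 4
    · obtain ⟨k, rfl⟩ : ∃ k, d = 3 * k + 1 := ⟨d / 3, by omega⟩
      have hleave : leave (2 * (3 * k + 1 + 1)) = 3 * k + 3 := by simp only [leave]; grind
      rw [hleave]
      ring_nf at hle ⊢
      omega
    · have hleave : leave (2 * (d + 1)) = d + 1 := by simp only [leave]; grind
      rw [hleave]
      linarith

theorem exists_isTrianglePacking_le_six_mul_card (n : ℕ) :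
    ∃ P, IsTrianglePacking (⊤ : SimpleGraph (Fin n)) P ∧ n * n ≤ 6 * #P + 2 * leave n + n := by
  rcases Nat.even_or_odd' n with ⟨d, rfl | rfl⟩
  · by_cases h4 : (2 * d) % 6 = 4
    · obtain ⟨P, hP, hcard⟩ := exists_isTrianglePacking_of_mod_six_eq_five
        (n := 2 * d + 1) (by omega)
      obtain ⟨Q, hQ, hPQ⟩ := hP.exists_pred
      refine ⟨Q, hQ, ?_⟩
      obtain ⟨k, rfl⟩ : ∃ k, d = 3 * k + 2 := ⟨d / 3, by omega⟩
      have hleave : leave (2 * (3 * k + 2)) = 3 * k + 3 := by simp only [leave]; grind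
      rw [hleave]
      suffices 6 * k * k + 6 * k + 1 ≤ #Q by nlinarith
      by_contra! h
      nlinarith
    · obtain ⟨P, hP, hcard⟩ := exists_isTrianglePacking_of_mod_six (n := 2 * d + 1) (by omega)
      obtain ⟨Q, hQ, hPQ⟩ := hP.exists_pred
      refine ⟨Q, hQ, ?_⟩
      have hleave : leave (2 * d) = d := by simp only [leave]; grind
      rw [hleave]
      nlinarith
  · by_cases h5 : (2 * d + 1) % 6 = 5
    · have hleave : leave (2 * d + 1) = 4 := by simp only [leave]; grind
      obtain ⟨P, hP, hcard⟩ := exists_isTrianglePacking_of_mod_six_eq_five h5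
      exact ⟨P, hP, by omega⟩
    · have hleave : leave (2 * d + 1) = 0 := by simp only [leave]; grind
      obtain ⟨P, hP, hcard⟩ := exists_isTrianglePacking_of_mod_six (n := 2 * d + 1) (by omega)
      exact ⟨P, hP, by omega⟩

theorem six_mul_nu_add (n : ℕ) :
    6 * nu (⊤ : SimpleGraph (Fin n)) + 2 * leave n + n = n * n := by
  obtain ⟨P, hP, hcard⟩ := exists_isTrianglePacking_le_six_mul_card n
  have hmax := six_mul_card_add_le hP
  rw [nu_eq_of_isTrianglePacking hP fun Q hQ => by have := six_mul_card_add_le hQ; omega]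
  omega

theorem cast_leave (n : ℕ) :
    (leave n : ℝ) = if n % 6 = 1 ∨ n % 6 = 3 then 0
      else if n % 6 = 5 then 4
      else if n % 6 = 4 then (n : ℝ) / 2 + 1
      else (n : ℝ) / 2 := by
  unfold leave
  split_ifs with h1 h5 h4
  · simp
  · simp
  · rw [Nat.cast_add_one, Nat.cast_div (by omega) (by simp), Nat.cast_two]
  · rw [Nat.cast_div (by omega) (by simp), Nat.cast_two]


/-- The exact maximum number of pairwise edge-disjoint triangles in the complete
graph `K_n`: `ν(K_n) = (1/3)(C(n,2) - k)` where `k` depends on `n mod 6`. -/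
theorem nu_completeGraph_eq (n : ℕ) (hn : 1 ≤ n) :
    (nu (⊤ : SimpleGraph (Fin n)) : ℝ) =
      (1 / 3) * ((n.choose 2 : ℝ) -
        (if n % 6 = 1 ∨ n % 6 = 3 then 0
         else if n % 6 = 5 then 4
         else if n % 6 = 4 then (n : ℝ) / 2 + 1
         else (n : ℝ) / 2)) := by
  have h : (6 * nu (⊤ : SimpleGraph (Fin n)) + 2 * leave n + n : ℝ) = n * n := by
    exact_mod_cast six_mul_nu_add n
  rw [← cast_leave, Nat.cast_choose_two]
  linarith
end

section
/- For every n ≥ 1, the maximum number ν(K_n) of pairwise edge-disjoint triangles in the complete graph K_n satisfies ν(K_n) ≥ (1/3)·(C(n,2) − n/2 − 3/2). -/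
open Finset SimpleGraph

theorem bddAbove_card_trianglePacking {V : Type*} [Fintype V] [DecidableEq V]
    (G : SimpleGraph V) :
    BddAbove {n | ∃ P : Finset (Finset V), IsTrianglePacking G P ∧ P.card = n} :=
  ⟨Fintype.card (Finset V), by rintro _ ⟨P, _, rfl⟩; exact P.card_le_univ⟩

theorem IsTrianglePacking.card_le_nu {V : Type*} [Fintype V] [DecidableEq V]
    {G : SimpleGraph V} {P : Finset (Finset V)} (hP : IsTrianglePacking G P) :
    P.card ≤ nu G :=
  le_csSup (bddAbove_card_trianglePacking G) ⟨P, hP, rfl⟩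

theorem exists_isTrianglePacking_card_eq_nu {V : Type*} [Fintype V] [DecidableEq V]
    (G : SimpleGraph V) : ∃ P, IsTrianglePacking G P ∧ P.card = nu G :=
  Nat.sSup_mem (s := {n | ∃ P : Finset (Finset V), IsTrianglePacking G P ∧ P.card = n})
    ⟨0, ∅, by simp [IsTrianglePacking], rfl⟩ (bddAbove_card_trianglePacking G)

/-- An indexed family of triples in which no pair of points lies in two different triples
gives a triangle packing of the complete graph. -/
theorem card_le_nu_of_triples {V ι : Type*} [Fintype V] [DecidableEq V] [Fintype ι] {n : ℕ}
    (hn : Fintype.card V = n) (blk : ι → Finset V) (h3 : ∀ p, (blk p).card = 3)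
    (hd : ∀ p q a b, a ≠ b → a ∈ blk p → b ∈ blk p → a ∈ blk q → b ∈ blk q → p = q) :
    Fintype.card ι ≤ nu (⊤ : SimpleGraph (Fin n)) := by
  classical
  let φ : V ≃ Fin n := Fintype.equivFinOfCardEq hn
  have hinj : Function.Injective fun p => (blk p).map φ.toEmbedding := by
    intro p q hpq
    have hpq : blk p = blk q := Finset.map_injective _ hpq
    obtain ⟨a, ha, b, hb, hab⟩ := Finset.one_lt_card.1 (by rw [h3 p]; norm_num : 1 < (blk p).card)
    exact hd p q a b hab ha hb (hpq ▸ ha) (hpq ▸ hb)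
  rw [← Finset.card_univ, ← Finset.card_image_of_injective _ hinj]
  apply IsTrianglePacking.card_le_nu
  refine ⟨?_, ?_⟩
  · intro t ht
    obtain ⟨p, -, rfl⟩ := Finset.mem_image.1 ht
    exact ⟨by simp [SimpleGraph.isClique_iff, Set.Pairwise], by simp [h3]⟩
  · intro t₁ h₁ t₂ h₂ hne
    obtain ⟨p, -, rfl⟩ := Finset.mem_image.1 h₁
    obtain ⟨q, -, rfl⟩ := Finset.mem_image.1 h₂
    by_contra! hlt
    rw [← Finset.map_inter, Finset.card_map] at hlt
    obtain ⟨a, ha, b, hb, hab⟩ := Finset.one_lt_card.1 hlt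
    rw [Finset.mem_inter] at ha hb
    exact hne (by rw [hd p q a b hab ha.1 hb.1 ha.2 hb.2])

/-- Deleting a point from a packing of `K_{n+1}` destroys at most `n / 2` triangles. -/
theorem nu_completeGraph_succ_le (n : ℕ) :
    nu (⊤ : SimpleGraph (Fin (n + 1))) ≤ nu (⊤ : SimpleGraph (Fin n)) + n / 2 := by
  classical
  obtain ⟨P, ⟨hP, hd⟩, hcard⟩ := exists_isTrianglePacking_card_eq_nu
    (⊤ : SimpleGraph (Fin (n + 1)))
  rw [← hcard, ← Finset.card_filter_add_card_filter_not (s := P) (fun t => Fin.last n ∉ t)]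
  refine Nat.add_le_add ?_ ?_
  · rw [← Fintype.card_coe]
    have hV : Fintype.card {x : Fin (n + 1) // x ≠ Fin.last n} = n := by simp
    refine card_le_nu_of_triples hV (fun t => t.1.subtype _) ?_ ?_
    · rintro ⟨t, ht⟩
      rw [Finset.mem_filter] at ht
      rw [Finset.card_subtype, Finset.filter_true_of_mem, (hP t ht.1).card_eq]
      rintro x hx rfl
      exact ht.2 hx
    · rintro ⟨t, ht⟩ ⟨s, hs⟩ a b hab ha hb ha' hb'
      rw [Finset.mem_filter] at ht hs
      simp only [Finset.mem_subtype] at ha hb ha' hb'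
      by_contra hne
      have hle := hd t ht.1 s hs.1 (by simpa using hne)
      have : 1 < (t ∩ s).card := Finset.one_lt_card.2
        ⟨a, by simp [ha, ha'], b, by simp [hb, hb'], by simpa [Subtype.ext_iff] using hab⟩
      omega
  · rw [Nat.le_div_iff_mul_le two_pos]
    set Q := P.filter (fun t => ¬ Fin.last n ∉ t) with hQ
    have hQP : ∀ t ∈ Q, t ∈ P ∧ Fin.last n ∈ t := by simp [hQ]
    have hdisj : (Q : Set (Finset (Fin (n + 1)))).PairwiseDisjoint
        (fun t => t.erase (Fin.last n)) := by
      intro t ht s hs hne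
      obtain ⟨ht, htl⟩ := hQP t ht
      obtain ⟨hs, hsl⟩ := hQP s hs
      refine Finset.disjoint_left.2 fun a ha hb => ?_
      rw [Finset.mem_erase] at ha hb
      have hle := hd t ht s hs hne
      have : 1 < (t ∩ s).card := Finset.one_lt_card.2
        ⟨a, by simp [ha, hb], Fin.last n, by simp [htl, hsl], ha.1⟩
      omega
    have hsum := Finset.card_biUnion hdisj
    rw [Finset.sum_congr rfl (g := fun _ => 2) fun t ht => by
      rw [Finset.card_erase_of_mem (hQP t ht).2, (hP t (hQP t ht).1).card_eq]] at hsum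
    have hsub : Q.biUnion (fun t => t.erase (Fin.last n)) ⊆ Finset.univ.erase (Fin.last n) := by
      intro a
      simp only [Finset.mem_biUnion, Finset.mem_erase, Finset.mem_univ]
      tauto
    have := Finset.card_le_card hsub
    simp at this hsum
    omega

/-- The Bose–Skolem construction: from a commutative quasigroup on `Fin m`, all triples
`(x, i), (y, i), (mul x y, i + 1)` with `x ≠ y` can be used together with any family of
edge-disjoint triples whose edges touch a new point or have the form
`(x, i), (mul x x, i + 1)`. -/
theorem three_mul_choose_add_card_le_nu {m n : ℕ} {S J : Type*} [Fintype S] [DecidableEq S]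
    [Fintype J] (hn : m * 3 + Fintype.card S = n) (mul : Fin m → Fin m → Fin m)
    (mul_comm : ∀ x y, mul x y = mul y x) (mul_cancel : ∀ x y z, mul x y = mul x z → y = z)
    (e : J → Finset (Fin m × Fin 3 ⊕ S)) (h3 : ∀ j, (e j).card = 3)
    (hd : ∀ p q a b, a ≠ b → a ∈ e p → b ∈ e p → a ∈ e q → b ∈ e q → p = q)
    (hloop : ∀ j x i y l, Sum.inl (x, i) ∈ e j → Sum.inl (y, l) ∈ e j → (x, i) ≠ (y, l) →
      l = i + 1 ∧ y = mul x x ∨ i = l + 1 ∧ x = mul y y) :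
    3 * m.choose 2 + Fintype.card J ≤ nu (⊤ : SimpleGraph (Fin n)) := by
  classical
  have hS : ∀ i : Fin 3, i ≠ i + 1 ∧ i ≠ i + 1 + 1 := by decide
  have hpairs : Fintype.card {p : Fin m × Fin m // p.1 < p.2} = m.choose 2 := by
    rw [Fintype.card_subtype, ← Finset.univ_product_univ, Finset.card_filter,
      Finset.sum_product_right]
    simp only [← Finset.card_filter, Finset.filter_gt_eq_Iio, Fin.card_Iio]
    rw [Fin.sum_univ_eq_sum_range (fun i => i), Finset.sum_range_id, Nat.choose_two_right]
  let blk : {p : Fin m × Fin m // p.1 < p.2} × Fin 3 ⊕ J → Finset (Fin m × Fin 3 ⊕ S) :=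
    Sum.elim (fun p => {Sum.inl (p.1.1.1, p.2), Sum.inl (p.1.1.2, p.2),
      Sum.inl (mul p.1.1.1 p.1.1.2, p.2 + 1)}) e
  have cross : ∀ p j a b, a ≠ b → a ∈ blk (Sum.inl p) → b ∈ blk (Sum.inl p) → a ∈ e j →
      b ∈ e j → False := by
    rintro ⟨⟨⟨x, y⟩, hxy⟩, i⟩ j a b hab ha hb ha' hb'
    have hxy : x ≠ y := ne_of_lt hxy
    simp only [blk, Sum.elim_inl, Finset.mem_insert, Finset.mem_singleton] at ha hb
    rcases ha with rfl | rfl | rfl <;> rcases hb with rfl | rfl | rfl <;>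
      have := hloop j _ _ _ _ ha' hb' (fun h => hab (congrArg _ h)) <;> grind
  have hcard : Fintype.card ({p : Fin m × Fin m // p.1 < p.2} × Fin 3 ⊕ J)
      = 3 * m.choose 2 + Fintype.card J := by
    rw [Fintype.card_sum, Fintype.card_prod, hpairs, Fintype.card_fin, Nat.mul_comm]
  rw [← hcard]
  refine card_le_nu_of_triples (by simpa using hn) blk ?_ ?_
  · rintro (⟨⟨⟨x, y⟩, hxy⟩, i⟩ | j)
    · have hxy : x ≠ y := ne_of_lt hxy
      refine Finset.card_eq_three.2 ⟨_, _, _, ?_, ?_, ?_, rfl⟩ <;> simp [hxy, hS]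
    · exact h3 j
  · rintro (p | p) (q | q) a b hab ha hb ha' hb'
    · obtain ⟨⟨⟨x, y⟩, hxy⟩, i⟩ := p
      obtain ⟨⟨⟨z, w⟩, hzw⟩, l⟩ := q
      simp only at hxy hzw
      simp only [blk, Sum.elim_inl, Finset.mem_insert, Finset.mem_singleton] at ha hb ha' hb'
      have key : i = l ∧ x = z ∧ y = w := by
        rcases ha with rfl | rfl | rfl <;> rcases hb with rfl | rfl | rfl <;>
          simp only [Sum.inl.injEq, Prod.mk.injEq, ne_eq, not_true_eq_false] at hab ha' hb' <;>
          grind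
      obtain ⟨rfl, rfl, rfl⟩ := key
      rfl
    · exact (cross p q a b hab ha hb ha' hb').elim
    · exact (cross q p a b hab ha' hb' ha hb).elim
    · rw [hd p q a b hab ha hb ha' hb']

/-- Half of `x + y` modulo `2 * k + 1`. -/
def oddMean (k : ℕ) (x y : Fin (2 * k + 1)) : Fin (2 * k + 1) :=
  ⟨if (x.1 + y.1) % 2 = 0 then (x.1 + y.1) / 2 else
    if x.1 + y.1 < 2 * k + 1 then (x.1 + y.1 + (2 * k + 1)) / 2
    else (x.1 + y.1 - (2 * k + 1)) / 2, by grind⟩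

theorem oddMean_comm (k : ℕ) (x y : Fin (2 * k + 1)) : oddMean k x y = oddMean k y x := by
  simp only [oddMean, Nat.add_comm]

theorem oddMean_cancel (k : ℕ) (x y z : Fin (2 * k + 1)) (h : oddMean k x y = oddMean k x z) :
    y = z := by
  simp only [oddMean, Fin.mk.injEq] at h
  ext
  grind

theorem oddMean_self (k : ℕ) (x : Fin (2 * k + 1)) : oddMean k x x = x := by
  ext
  simp only [oddMean]
  grind

/-- A half-idempotent commutative quasigroup of order `2 * k`. -/
def evenMean (k : ℕ) (x y : Fin (2 * k)) : Fin (2 * k) :=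
  ⟨(if x.1 + y.1 < 2 * k then x.1 + y.1 else x.1 + y.1 - 2 * k) / 2 +
    if (x.1 + y.1) % 2 = 0 then 0 else k, by grind⟩

theorem evenMean_comm (k : ℕ) (x y : Fin (2 * k)) : evenMean k x y = evenMean k y x := by
  simp only [evenMean, Nat.add_comm]

theorem evenMean_cancel (k : ℕ) (x y z : Fin (2 * k)) (h : evenMean k x y = evenMean k x z) :
    y = z := by
  simp only [evenMean, Fin.mk.injEq] at h
  ext
  grind

theorem evenMean_self (k : ℕ) (x : Fin (2 * k)) :
    (evenMean k x x).1 = if x.1 < k then x.1 else x.1 - k := by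
  simp only [evenMean]
  grind

theorem le_nu_six_mul_add_three (k : ℕ) :
    3 * (2 * k + 1).choose 2 + (2 * k + 1) ≤ nu (⊤ : SimpleGraph (Fin (6 * k + 3))) := by
  have H := three_mul_choose_add_card_le_nu (n := 6 * k + 3) (S := Empty) (J := Fin (2 * k + 1))
    (by simp; ring) (oddMean k) (oddMean_comm k) (oddMean_cancel k)
    (fun x => {Sum.inl (x, 0), Sum.inl (x, 1), Sum.inl (x, 2)}) ?_ ?_ ?_
  · simpa using H
  · intro x
    refine Finset.card_eq_three.2 ⟨_, _, _, ?_, ?_, ?_, rfl⟩ <;> simp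
  · intro p q a b hab ha hb ha' hb'
    simp only [Finset.mem_insert, Finset.mem_singleton] at ha hb ha' hb'
    grind
  · intro p x i y l hx hy hne
    simp only [Finset.mem_insert, Finset.mem_singleton, Sum.inl.injEq, Prod.mk.injEq] at hx hy
    rw [oddMean_self, oddMean_self]
    grind

theorem le_nu_six_mul_add_one (k : ℕ) :
    3 * (2 * k).choose 2 + (k + k * 3) ≤ nu (⊤ : SimpleGraph (Fin (6 * k + 1))) := by
  let lo : Fin k → Fin (2 * k) := fun x => ⟨x.1, by omega⟩
  let hi : Fin k → Fin (2 * k) := fun x => ⟨x.1 + k, by omega⟩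
  have hlohi : ∀ x y, lo x ≠ hi y := by simp [lo, hi, Fin.ext_iff]; omega
  have slo : ∀ x, evenMean k (lo x) (lo x) = lo x := by
    intro x; ext; rw [evenMean_self]; simp [lo]
  have shi : ∀ x, evenMean k (hi x) (hi x) = lo x := by
    intro x; ext; rw [evenMean_self]; simp [lo, hi]
  have H := three_mul_choose_add_card_le_nu (n := 6 * k + 1) (S := Unit)
    (J := Fin k ⊕ Fin k × Fin 3)
    (by simp; ring) (evenMean k) (evenMean_comm k) (evenMean_cancel k)
    (Sum.elim (fun x => {Sum.inl (lo x, 0), Sum.inl (lo x, 1), Sum.inl (lo x, 2)})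
      (fun p => {Sum.inr (), Sum.inl (hi p.1, p.2), Sum.inl (lo p.1, p.2 + 1)})) ?_ ?_ ?_
  · simpa using H
  · rintro (x | x) <;>
      refine Finset.card_eq_three.2 ⟨_, _, _, ?_, ?_, ?_, rfl⟩ <;> simp [(hlohi _ _).symm]
  · rintro (p | ⟨p, i⟩) (q | ⟨q, j⟩) a b hab ha hb ha' hb' <;>
      simp only [Sum.elim_inl, Sum.elim_inr, Finset.mem_insert, Finset.mem_singleton]
        at ha hb ha' hb' <;>
      grind
  · rintro (p | ⟨p, i⟩) x i y l hx hy hne <;>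
      simp only [Sum.elim_inl, Sum.elim_inr, Finset.mem_insert, Finset.mem_singleton,
        Sum.inl.injEq, Prod.mk.injEq, reduceCtorEq, false_or] at hx hy <;>
      grind

theorem le_nu_six_mul_add_four (k : ℕ) :
    3 * (2 * k + 1).choose 2 + (k * 3 + 1) ≤ nu (⊤ : SimpleGraph (Fin (6 * k + 4))) := by
  let lo : Fin k → Fin (2 * k + 1) := fun x => ⟨x.1, by omega⟩
  let mid : Fin (2 * k + 1) := ⟨k, by omega⟩
  have hlohi : ∀ x y, lo x ≠ (lo y).rev := by simp [lo, Fin.ext_iff, Fin.val_rev]; omega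
  have H := three_mul_choose_add_card_le_nu (n := 6 * k + 4) (S := Unit)
    (J := Option (Fin k × Fin 3))
    (by simp; ring) (fun x y => (oddMean k x y).rev)
    (fun x y => congrArg _ (oddMean_comm k x y))
    (fun x y z h => oddMean_cancel k x y z (Fin.rev_injective h))
    (fun o => o.elim {Sum.inl (mid, 0), Sum.inl (mid, 1), Sum.inl (mid, 2)}
      (fun p => {Sum.inr (), Sum.inl (lo p.1, p.2), Sum.inl ((lo p.1).rev, p.2 + 1)})) ?_ ?_ ?_
  · simpa using H
  · rintro (_ | x) <;>
      refine Finset.card_eq_three.2 ⟨_, _, _, ?_, ?_, ?_, rfl⟩ <;> simp [hlohi]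
  · rintro (_ | ⟨p, i⟩) (_ | ⟨q, j⟩) a b hab ha hb ha' hb' <;>
      simp only [Option.elim_none, Option.elim_some, Finset.mem_insert, Finset.mem_singleton]
        at ha hb ha' hb' <;>
      grind
  · rintro (_ | ⟨p, i⟩) x i y l hx hy hne <;>
      simp only [Option.elim_none, Option.elim_some, Finset.mem_insert, Finset.mem_singleton,
        Sum.inl.injEq, Prod.mk.injEq, reduceCtorEq, false_or] at hx hy <;>
      simp only [oddMean_self] <;>
      grind

theorem le_nu_six_mul_add_five (k : ℕ) :
    3 * (2 * k + 1).choose 2 + (2 + k * 3 * 2) ≤ nu (⊤ : SimpleGraph (Fin (6 * k + 5))) := by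
  let lo : Fin k → Fin (2 * k + 1) := fun x => ⟨x.1, by omega⟩
  let mid : Fin (2 * k + 1) := ⟨k, by omega⟩
  let pt : Fin k → Bool → Fin (2 * k + 1) := fun x b => bif b then lo x else (lo x).rev
  have hpt : ∀ x y b c, pt x b = pt y c → x = y ∧ b = c := by
    intro x y b c h
    cases b <;> cases c <;> simp [pt, lo, Fin.ext_iff, Fin.val_rev] at h ⊢ <;> omega
  have H := three_mul_choose_add_card_le_nu (n := 6 * k + 5) (S := Bool)
    (J := Bool ⊕ (Fin k × Fin 3) × Bool)
    (by simp; ring) (fun x y => (oddMean k x y).rev)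
    (fun x y => congrArg _ (oddMean_comm k x y))
    (fun x y z h => oddMean_cancel k x y z (Fin.rev_injective h))
    (Sum.elim (fun b => {Sum.inr b, Sum.inl (mid, 0), Sum.inl (mid, bif b then 1 else 2)})
      (fun p => {Sum.inr p.2, Sum.inl (pt p.1.1 p.2, p.1.2),
        Sum.inl (pt p.1.1 (!p.2), p.1.2 + 1)})) ?_ ?_ ?_
  · simpa using H
  · rintro (b | ⟨⟨x, i⟩, b⟩)
    · refine Finset.card_eq_three.2 ⟨_, _, _, ?_, ?_, ?_, rfl⟩ <;> cases b <;> simp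
    · refine Finset.card_eq_three.2 ⟨_, _, _, ?_, ?_, ?_, rfl⟩ <;> simp
  · rintro (b | ⟨⟨p, i⟩, b⟩) (c | ⟨⟨q, j⟩, c⟩) a b hab ha hb ha' hb' <;>
      simp only [Sum.elim_inl, Sum.elim_inr, Finset.mem_insert, Finset.mem_singleton]
        at ha hb ha' hb' <;>
      grind
  · rintro (b | ⟨⟨p, i⟩, b⟩) x i y l hx hy hne <;>
      simp only [Sum.elim_inl, Sum.elim_inr, Finset.mem_insert, Finset.mem_singleton,
        Sum.inl.injEq, Prod.mk.injEq, reduceCtorEq, false_or] at hx hy <;>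
      simp only [oddMean_self] <;>
      grind

/-- For every `n ≥ 1`, `ν(K_n) ≥ (1/3)(C(n,2) - n/2 - 3/2)`. -/
theorem nu_completeGraph_ge (n : ℕ) (hn : 1 ≤ n) :
    (nu (⊤ : SimpleGraph (Fin n)) : ℝ) ≥
      (1 / 3) * ((n.choose 2 : ℝ) - (n : ℝ) / 2 - 3 / 2) := by
  have choose_cast : ∀ m : ℕ, ((m.choose 2 : ℕ) : ℝ) = m * (m - 1) / 2 := Nat.cast_choose_two ℝ
  obtain ⟨k, hk⟩ : ∃ k, n = 6 * k + 1 ∨ n = 6 * k + 2 ∨ n = 6 * k + 3 ∨ n = 6 * k + 4 ∨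
      n = 6 * k + 5 ∨ n = 6 * k + 6 := ⟨(n - 1) / 6, by omega⟩
  rw [choose_cast]
  rcases hk with rfl | rfl | rfl | rfl | rfl | rfl
  · have h : ((_ : ℕ) : ℝ) ≤ (_ : ℕ) := Nat.cast_le.2 (le_nu_six_mul_add_one k)
    push_cast [choose_cast] at h ⊢
    nlinarith
  · have hdel := nu_completeGraph_succ_le (6 * k + 2)
    rw [show (6 * k + 2) / 2 = 3 * k + 1 by omega] at hdel
    have h : ((_ : ℕ) : ℝ) ≤ (_ : ℕ) := Nat.cast_le.2 ((le_nu_six_mul_add_three k).trans hdel)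
    push_cast [choose_cast] at h ⊢
    nlinarith
  · have h : ((_ : ℕ) : ℝ) ≤ (_ : ℕ) := Nat.cast_le.2 (le_nu_six_mul_add_three k)
    push_cast [choose_cast] at h ⊢
    nlinarith
  · have h : ((_ : ℕ) : ℝ) ≤ (_ : ℕ) := Nat.cast_le.2 (le_nu_six_mul_add_four k)
    push_cast [choose_cast] at h ⊢
    nlinarith
  · have h : ((_ : ℕ) : ℝ) ≤ (_ : ℕ) := Nat.cast_le.2 (le_nu_six_mul_add_five k)
    push_cast [choose_cast] at h ⊢
    nlinarith
  · have hdel := nu_completeGraph_succ_le (6 * k + 6)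
    rw [show (6 * k + 6) / 2 = 3 * k + 3 by omega] at hdel
    have h : ((_ : ℕ) : ℝ) ≤ (_ : ℕ) := Nat.cast_le.2 ((le_nu_six_mul_add_one (k + 1)).trans hdel)
    push_cast [choose_cast] at h ⊢
    nlinarith
end
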